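/- arXiv:2602.01883 — 2 statements merged into one kernel-verified Lean document; each statement's English description precedes it below -/
import Mathlib

section
/- (Continuous HiSD: exponential gradient decay and trajectory convergence.) Let θ : [0,∞) → ℝ^d be continuously differentiable and solve θ'(t) = −(I − 2 Σ_{p=1}^{k} v_p(t) v_p(t)ᵀ) ∇E(θ(t)), where for each t the vectors v_1(t),…,v_k(t) ∈ ℝ^d are arbitrary. Suppose there is a constant η > 0 such that for every t ≥ 0 one has (d/dt) G(θ(t)) ≤ −2η·G(θ(t)) where G(ϑ) = (1/2)‖∇E(ϑ)‖₂². Then ‖∇E(θ(t))‖₂ ≤ C₀ e^{−ηt} with C₀ = ‖∇E(θ(0))‖₂, the bound ‖θ(t+τ) − θ(t)‖₂ ≤ (C₀/η) e^{−ηt} holds for all t ≥ 0 and τ > 0, the limit θ* = lim_{t→∞} θ(t) exists with ‖θ(t) − θ*‖₂ ≤ (C₀/η) e^{−ηt}, and ∇E(θ*) = 0. -/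
open scoped RealInnerProductSpace

noncomputable section

theorem stmt9 {d k : ℕ} (f : EuclideanSpace ℝ (Fin d) → ℝ) (hf : ContDiff ℝ 2 f)
    (θ θ' : ℝ → EuclideanSpace ℝ (Fin d)) (v : ℕ → ℝ → EuclideanSpace ℝ (Fin d))
    (hθ : ∀ t : ℝ, 0 ≤ t → HasDerivAt θ (θ' t) t)
    (hode : ∀ t : ℝ, 0 ≤ t → θ' t =
      -(gradient f (θ t) -
        (2 : ℝ) • ∑ p ∈ Finset.range k, ⟪v p t, gradient f (θ t)⟫ • v p t))
    (hnorm : ∀ t : ℝ, 0 ≤ t → ‖θ' t‖ = ‖gradient f (θ t)‖)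
    (η : ℝ) (hη : 0 < η)
    (Gd : ℝ → ℝ)
    (hGd : ∀ t : ℝ, 0 ≤ t →
      HasDerivAt (fun s => (1/2) * ‖gradient f (θ s)‖ ^ 2) (Gd t) t)
    (hdecay : ∀ t : ℝ, 0 ≤ t → Gd t ≤ -(2 * η) * ((1/2) * ‖gradient f (θ t)‖ ^ 2)) :
    (∀ t : ℝ, 0 ≤ t → ‖gradient f (θ t)‖ ≤ ‖gradient f (θ 0)‖ * Real.exp (-η * t)) ∧
    (∀ t : ℝ, 0 ≤ t → ∀ τ : ℝ, 0 < τ →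
      ‖θ (t + τ) - θ t‖ ≤ (‖gradient f (θ 0)‖ / η) * Real.exp (-η * t)) ∧
    (∃ θstar : EuclideanSpace ℝ (Fin d),
      Filter.Tendsto θ Filter.atTop (nhds θstar) ∧
      (∀ t : ℝ, 0 ≤ t → ‖θ t - θstar‖ ≤ (‖gradient f (θ 0)‖ / η) * Real.exp (-η * t)) ∧
      gradient f θstar = 0) := by
  have h1 : ∀ t : ℝ, 0 ≤ t →
      ‖gradient f (θ t)‖ ≤ ‖gradient f (θ 0)‖ * Real.exp (-η * t) := by
    intro t ht
    have hE : ∀ s : ℝ, HasDerivAt (fun s => Real.exp (2 * η * s))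
        (Real.exp (2 * η * s) * (2 * η)) s := by
      intro s
      simpa using ((hasDerivAt_id s).const_mul (2 * η)).exp
    have hd : ∀ s : ℝ, 0 ≤ s → HasDerivAt
        (fun s => ((1/2) * ‖gradient f (θ s)‖ ^ 2) * Real.exp (2 * η * s))
        (Gd s * Real.exp (2 * η * s) +
          ((1/2) * ‖gradient f (θ s)‖ ^ 2) * (Real.exp (2 * η * s) * (2 * η))) s :=
      fun s hs => (hGd s hs).mul (hE s)
    have hanti : AntitoneOn
        (fun s => ((1/2) * ‖gradient f (θ s)‖ ^ 2) * Real.exp (2 * η * s)) (Set.Ici 0) := by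
      apply antitoneOn_of_hasDerivWithinAt_nonpos (convex_Ici 0)
      · exact fun s hs => (hd s hs).continuousAt.continuousWithinAt
      · intro s hs
        exact (hd s (interior_subset hs)).hasDerivWithinAt
      · intro s hs
        have h := hdecay s (interior_subset hs)
        nlinarith [Real.exp_pos (2 * η * s)]
    have h := hanti (Set.mem_Ici.2 le_rfl) (Set.mem_Ici.2 ht) ht
    simp only [mul_zero, Real.exp_zero, mul_one] at h
    have hexp : Real.exp (2 * η * t) = Real.exp (η * t) ^ 2 := by
      rw [← Real.exp_nat_mul]; congr 1; push_cast; ring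
    have h' : ‖gradient f (θ t)‖ * Real.exp (η * t) ≤ ‖gradient f (θ 0)‖ := by
      apply le_of_pow_le_pow_left₀ two_ne_zero (norm_nonneg _)
      rw [mul_pow, ← hexp]; linarith
    rw [neg_mul, Real.exp_neg, ← div_eq_mul_inv, le_div_iff₀ (Real.exp_pos _)]
    exact h'
  have h2 : ∀ t : ℝ, 0 ≤ t → ∀ τ : ℝ, 0 < τ →
      ‖θ (t + τ) - θ t‖ ≤ (‖gradient f (θ 0)‖ / η) * Real.exp (-η * t) := by
    intro t ht τ hτ
    have hB : ∀ s : ℝ, HasDerivAt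
        (fun s => (‖gradient f (θ 0)‖ / η) * (Real.exp (-η * t) - Real.exp (-η * s)))
        (‖gradient f (θ 0)‖ * Real.exp (-η * s)) s := by
      intro s
      have := ((((hasDerivAt_id s).const_mul (-η)).exp).const_sub
        (Real.exp (-η * t))).const_mul (‖gradient f (θ 0)‖ / η)
      refine this.congr_deriv ?_
      simp only [id]
      field_simp
    have key := image_norm_le_of_norm_deriv_right_le_deriv_boundary
      (f := fun s => θ s - θ t) (f' := θ') (a := t) (b := t + τ)
      (fun s hs => ((hθ s (ht.trans hs.1)).sub_const _).continuousAt.continuousWithinAt)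
      (fun s hs => ((hθ s (ht.trans hs.1)).sub_const _).hasDerivWithinAt)
      (by simp) hB
      (fun s hs => by
        rw [hnorm s (ht.trans hs.1)]; exact h1 s (ht.trans hs.1))
      (Set.right_mem_Icc.2 (by linarith))
    refine key.trans ?_
    have : 0 ≤ ‖gradient f (θ 0)‖ / η := by positivity
    apply mul_le_mul_of_nonneg_left _ this
    linarith [Real.exp_pos (-η * (t + τ))]
  refine ⟨h1, h2, ?_⟩
  have h2' : ∀ t : ℝ, 0 ≤ t → ∀ s : ℝ, t ≤ s →
      ‖θ t - θ s‖ ≤ (‖gradient f (θ 0)‖ / η) * Real.exp (-η * t) := by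
    intro t ht s hs
    rcases hs.eq_or_lt with rfl | h
    · rw [sub_self, norm_zero]; positivity
    · have := h2 t ht (s - t) (by linarith)
      rwa [add_sub_cancel, norm_sub_rev] at this
  have hexp0 : Filter.Tendsto (fun t : ℝ => Real.exp (-η * t)) Filter.atTop (nhds 0) :=
    Real.tendsto_exp_atBot.comp
      (Filter.tendsto_id.const_mul_atTop_of_neg (by linarith : -η < 0))
  have hmax : (fun t : ℝ => max t 0) =ᶠ[Filter.atTop] id := by
    filter_upwards [Filter.eventually_ge_atTop 0] with t ht
    exact max_eq_left ht
  have hcau : CauchySeq (fun t : ℝ => θ (max t 0)) := by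
    refine cauchySeq_of_le_tendsto_0'
      (fun t : ℝ => (‖gradient f (θ 0)‖ / η) * Real.exp (-η * max t 0)) ?_ ?_
    · intro t s hts
      rw [dist_eq_norm]
      exact h2' _ (le_max_right _ _) _ (max_le_max_right 0 hts)
    · have := hexp0.const_mul (‖gradient f (θ 0)‖ / η)
      rw [mul_zero] at this
      refine this.congr' ?_
      filter_upwards [hmax] with t ht
      rw [ht, id]
  obtain ⟨x, hx⟩ := cauchySeq_tendsto_of_complete hcau
  have hx' : Filter.Tendsto θ Filter.atTop (nhds x) := by
    refine hx.congr' ?_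
    filter_upwards [hmax] with t ht
    rw [ht, id]
  refine ⟨x, hx', ?_, ?_⟩
  · intro t ht
    refine le_of_tendsto (hx'.const_sub (θ t)).norm ?_
    filter_upwards [Filter.eventually_ge_atTop t] with s hs
    exact h2' t ht s hs
  · have hcont : Continuous (gradient f) :=
      (InnerProductSpace.toDual ℝ (EuclideanSpace ℝ (Fin d))).symm.continuous.comp
        (hf.continuous_fderiv (by norm_num))
    have ha := ((hcont.tendsto x).comp hx').norm
    have hb := hexp0.const_mul ‖gradient f (θ 0)‖
    rw [mul_zero] at hb
    have hle : ‖gradient f x‖ ≤ 0 := by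
      refine le_of_tendsto_of_tendsto ha hb ?_
      filter_upwards [Filter.eventually_ge_atTop 0] with s hs
      exact h1 s hs
    exact norm_le_zero_iff.1 hle
end
end

section
/- (Linear convergence of discrete k-HiSD to the critical manifold.) Let k be an integer with s ≤ k ≤ s+m and fix a step size 0 < β ≤ 2/(L+μ). Let {θ^{(t)}}_{t≥0} be generated by θ^{(t+1)} = θ^{(t)} − β (I − 2 Σ_{p=1}^{k} v_p^{(t)} (v_p^{(t)})ᵀ) ∇E(θ^{(t)}), where for each t the vectors v_1^{(t)},…,v_k^{(t)} are orthonormal with v_p^{(t)} = u_p^{(t)} for 1 ≤ p ≤ s and v_p^{(t)} ∈ U^{(t)} for s+1 ≤ p ≤ k. Assume for every t ≥ 0 there is a critical point θ̂^{(t)} such that the pair (θ^{(t)}, θ̂^{(t)}) satisfies conditions (i)–(v) of the context, and that the nearest-point property ‖θ^{(t+1)} − θ̂^{(t+1)}‖₂ ≤ ‖θ^{(t+1)} − θ̂^{(t)}‖₂ holds. If r_0 = ‖θ^{(0)} − θ̂^{(0)}‖₂ < r̂ := 2μ²β / ((5μβ + 4)M), then r_t = ‖θ^{(t)} − θ̂^{(t)}‖₂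 is monotonically decreasing and satisfies r_t ≤ (1 + μβ)^{−t} · r̂ r_0 / (r̂ − r_0) for all t ≥ 0; in particular r_t → 0 as t → ∞. -/
open scoped RealInnerProductSpace

noncomputable section

def rk1 {d : ℕ} (u : EuclideanSpace ℝ (Fin d)) :
    EuclideanSpace ℝ (Fin d) →L[ℝ] EuclideanSpace ℝ (Fin d) :=
  (innerSL ℝ u).smulRight u

/-- Norm of a rescaled orthonormal sum. -/
theorem aux_norm_sq {d : ℕ} (u : Fin d → EuclideanSpace ℝ (Fin d)) (hu : Orthonormal ℝ u)
    (S : Finset (Fin d)) (c : Fin d → ℝ) :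
    ‖∑ p ∈ S, c p • u p‖ ^ 2 = ∑ p ∈ S, c p ^ 2 := by
  rw [← real_inner_self_eq_norm_sq, hu.inner_sum]
  simp [sq]

theorem aux_norm_le {d : ℕ} (u : Fin d → EuclideanSpace ℝ (Fin d)) (hu : Orthonormal ℝ u)
    (S : Finset (Fin d)) (a c : Fin d → ℝ) (C : ℝ) (hC : 0 ≤ C) (ha : ∀ p ∈ S, |a p| ≤ C) :
    ‖∑ p ∈ S, (a p * c p) • u p‖ ≤ C * ‖∑ p ∈ S, c p • u p‖ := by
  apply le_of_sq_le_sq _ (by positivity)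
  rw [mul_pow, aux_norm_sq u hu S (fun p => a p * c p), aux_norm_sq u hu, Finset.mul_sum]
  apply Finset.sum_le_sum
  intro p hp
  rw [mul_pow]
  have := sq_le_sq' (by linarith [abs_nonneg (a p), ha p hp, (abs_le.mp (ha p hp)).1]) (abs_le.mp (ha p hp)).2
  nlinarith [sq_nonneg (c p)]

theorem aux_expand {d : ℕ} (u : Fin d → EuclideanSpace ℝ (Fin d)) (hu : Orthonormal ℝ u)
    (x : EuclideanSpace ℝ (Fin d)) : x = ∑ p, ⟪u p, x⟫ • u p := by
  have hspan : ⊤ ≤ Submodule.span ℝ (Set.range u) := by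
    have := hu.linearIndependent.span_eq_top_of_card_eq_finrank' (by simp)
    exact this.ge
  have := (OrthonormalBasis.mk hu hspan).sum_repr' x
  simpa using this.symm

theorem aux_inter {d : ℕ} (u v : Fin d → EuclideanSpace ℝ (Fin d)) (A B : Finset (Fin d))
    (h : A.card + B.card < d) :
    ∃ x : EuclideanSpace ℝ (Fin d), x ≠ 0 ∧ (∀ p ∈ A, ⟪u p, x⟫ = 0) ∧ (∀ p ∈ B, ⟪v p, x⟫ = 0) := by
  let T : EuclideanSpace ℝ (Fin d) →ₗ[ℝ] ((A → ℝ) × (B → ℝ)) :=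
    LinearMap.prod (LinearMap.pi fun p => (innerSL ℝ (u p)).toLinearMap)
      (LinearMap.pi fun p => (innerSL ℝ (v p)).toLinearMap)
  have hk : LinearMap.ker T ≠ ⊥ := by
    apply LinearMap.ker_ne_bot_of_finrank_lt
    simpa using h
  obtain ⟨x, hx, hx0⟩ := (Submodule.ne_bot_iff _).mp hk
  have hT : T x = 0 := hx
  refine ⟨x, hx0, fun p hp => ?_, fun p hp => ?_⟩
  · simpa [T] using congrFun (congrArg Prod.fst hT) ⟨p, hp⟩
  · simpa [T] using congrFun (congrArg Prod.snd hT) ⟨p, hp⟩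

/-- quadratic form in an eigenbasis -/
theorem aux_quad {d : ℕ} (A : EuclideanSpace ℝ (Fin d) →L[ℝ] EuclideanSpace ℝ (Fin d))
    (lam : Fin d → ℝ) (u : Fin d → EuclideanSpace ℝ (Fin d)) (hu : Orthonormal ℝ u)
    (heig : ∀ p, A (u p) = lam p • u p) (x : EuclideanSpace ℝ (Fin d)) :
    ⟪x, A x⟫ = ∑ p, lam p * ⟪u p, x⟫ ^ 2 := by
  have hx := aux_expand u hu x
  have hA : A x = ∑ p, (⟪u p, x⟫ * lam p) • u p := by
    conv_lhs => rw [hx]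
    simp [map_sum, heig, smul_smul]
  rw [hA, inner_sum]
  apply Finset.sum_congr rfl
  intro p _
  rw [inner_smul_right, real_inner_comm]
  ring

theorem aux_nsq {d : ℕ} (u : Fin d → EuclideanSpace ℝ (Fin d)) (hu : Orthonormal ℝ u)
    (x : EuclideanSpace ℝ (Fin d)) : ‖x‖ ^ 2 = ∑ p, ⟪u p, x⟫ ^ 2 := by
  conv_lhs => rw [aux_expand u hu x]
  exact aux_norm_sq u hu Finset.univ (fun p => ⟪u p, x⟫)

/-- One-sided Weyl-type bound. -/
theorem aux_weyl {d : ℕ} (A B : EuclideanSpace ℝ (Fin d) →L[ℝ] EuclideanSpace ℝ (Fin d))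
    (a b : Fin d → ℝ) (u w : Fin d → EuclideanSpace ℝ (Fin d)) (hu : Orthonormal ℝ u)
    (hw : Orthonormal ℝ w) (hA : ∀ p, A (u p) = a p • u p) (hB : ∀ p, B (w p) = b p • w p)
    (S T : Finset (Fin d)) (hST : S.card + T.card < d) (α η : ℝ)
    (hS : ∀ p ∉ S, a p ≤ α) (hT : ∀ p ∉ T, 0 ≤ b p) (hη : ‖A - B‖ ≤ η) : -η ≤ α := by
  obtain ⟨x, hx0, hxS, hxT⟩ := aux_inter u w S T hST
  have hxn : 0 < ‖x‖ := norm_pos_iff.mpr hx0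
  have h1 : ⟪x, A x⟫ ≤ α * ‖x‖ ^ 2 := by
    rw [aux_quad A a u hu hA, aux_nsq u hu x, Finset.mul_sum]
    apply Finset.sum_le_sum
    intro p _
    by_cases hp : p ∈ S
    · simp [hxS p hp]
    · exact mul_le_mul_of_nonneg_right (hS p hp) (sq_nonneg _)
  have h2 : 0 ≤ ⟪x, B x⟫ := by
    rw [aux_quad B b w hw hB]
    apply Finset.sum_nonneg
    intro p _
    by_cases hp : p ∈ T
    · simp [hxT p hp]
    · exact mul_nonneg (hT p hp) (sq_nonneg _)
  have h3 : |⟪x, (A - B) x⟫| ≤ η * ‖x‖ ^ 2 := by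
    calc |⟪x, (A - B) x⟫| ≤ ‖x‖ * ‖(A - B) x‖ := abs_real_inner_le_norm _ _
      _ ≤ ‖x‖ * (η * ‖x‖) := by
        gcongr
        exact (A - B).le_of_opNorm_le hη x
      _ = _ := by ring
  have h4 : ⟪x, (A - B) x⟫ = ⟪x, A x⟫ - ⟪x, B x⟫ := by
    rw [sub_apply, inner_sub_right]
  have h5 := (abs_le.mp h3).1
  have : 0 ≤ (α + η) * ‖x‖ ^ 2 := by nlinarith
  have := nonneg_of_mul_nonneg_left this (by positivity)
  linarith

/-- Weyl: the middle eigenvalues are small. -/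
theorem aux_middle {d s m : ℕ} (hsm : s + m ≤ d)
    (A B : EuclideanSpace ℝ (Fin d) →L[ℝ] EuclideanSpace ℝ (Fin d))
    (a b : Fin d → ℝ) (u w : Fin d → EuclideanSpace ℝ (Fin d)) (hu : Orthonormal ℝ u)
    (hw : Orthonormal ℝ w) (hA : ∀ p, A (u p) = a p • u p) (hB : ∀ p, B (w p) = b p • w p)
    (ha : Monotone a) (hb1 : ∀ p : Fin d, (p : ℕ) < s + m → b p ≤ 0)
    (hb2 : ∀ p : Fin d, s ≤ (p : ℕ) → 0 ≤ b p) (η : ℝ) (hη : ‖A - B‖ ≤ η)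
    (p : Fin d) (hp1 : s ≤ (p : ℕ)) (hp2 : (p : ℕ) < s + m) : |a p| ≤ η := by
  have hpd := p.2
  rw [abs_le]
  constructor
  · apply aux_weyl A B a b u w hu hw hA hB (Finset.Ioi p)
      (Finset.univ.filter (fun q : Fin d => (q : ℕ) < s)) ?_ (a p) η ?_ ?_ hη
    · rw [Fin.card_Ioi, Fin.card_filter_val_lt]
      omega
    · intro q hq
      apply ha
      simpa using hq
    · intro q hq
      apply hb2
      simpa using hq
  · have := aux_weyl (-A) (-B) (fun p => - a p) (fun p => - b p) u w hu hw
      (fun p => by simp [hA]) (fun p => by simp [hB]) (Finset.Iio p)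
      (Finset.univ.filter (fun q : Fin d => s + m ≤ (q : ℕ))) ?_ (- a p) η ?_ ?_ ?_
    · linarith
    · have hc := Finset.card_filter_add_card_filter_not (s := (Finset.univ : Finset (Fin d)))
        (fun q : Fin d => (q : ℕ) < s + m)
      rw [Fin.card_filter_val_lt] at hc
      simp only [not_lt, Finset.card_univ, Fintype.card_fin] at hc
      rw [Fin.card_Iio]
      omega
    · intro q hq
      simp only [Finset.mem_Iio, not_lt] at hq
      have := ha hq
      linarith
    · intro q hq
      simp only [Finset.mem_filter, Finset.mem_univ, true_and, not_le] at hq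
      have := hb1 q hq
      linarith
    · rw [← norm_neg]
      simpa [sub_eq_add_neg, add_comm] using hη

/-- Taylor remainder. -/
theorem aux_taylor {d : ℕ} (G : EuclideanSpace ℝ (Fin d) → EuclideanSpace ℝ (Fin d))
    (H : EuclideanSpace ℝ (Fin d) → EuclideanSpace ℝ (Fin d) →L[ℝ] EuclideanSpace ℝ (Fin d))
    (hH : ∀ x, HasFDerivAt G (H x) x) (x y : EuclideanSpace ℝ (Fin d)) (hy : G y = 0)
    (M δ : ℝ) (hM : 0 < M) (hc : ‖x - y‖ < δ)
    (hLip : ∀ a ∈ Metric.closedBall y δ, ∀ b ∈ Metric.closedBall y δ,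
      ‖H a - H b‖ ≤ M * ‖a - b‖) :
    ‖G x - H x (x - y)‖ ≤ M * ‖x - y‖ ^ 2 / 2 := by
  set e := x - y with he
  have hxe : x = y + e := by rw [he]; abel
  have hxb : x ∈ Metric.closedBall y δ := by
    rw [Metric.mem_closedBall, dist_eq_norm]; exact hc.le
  let φ : ℝ → EuclideanSpace ℝ (Fin d) := fun τ => G (y + τ • e) - τ • H x e
  have hφ : ∀ τ : ℝ, HasDerivAt φ (H (y + τ • e) e - H x e) τ := by
    intro τ
    have h1 : HasDerivAt (fun τ : ℝ => y + τ • e) e τ := by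
      simpa using ((hasDerivAt_id τ).smul_const e).const_add y
    have h2 := (hH (y + τ • e)).comp_hasDerivAt τ h1
    have h3 : HasDerivAt (fun τ : ℝ => τ • H x e) (H x e) τ := by
      simpa using (hasDerivAt_id τ).smul_const (H x e)
    exact h2.sub h3
  have key := image_norm_le_of_norm_deriv_right_le_deriv_boundary' (f := φ)
    (f' := fun τ => H (y + τ • e) e - H x e) (a := 0) (b := 1)
    (B := fun τ => M * ‖e‖ ^ 2 * (τ - τ ^ 2 / 2)) (B' := fun τ => M * ‖e‖ ^ 2 * (1 - τ))
    (fun τ _ => (hφ τ).continuousAt.continuousWithinAt)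
    (fun τ _ => (hφ τ).hasDerivWithinAt)
    (by simp [φ, hy])
    (by fun_prop)
    (fun τ _ => by
      have : HasDerivAt (fun τ : ℝ => M * ‖e‖ ^ 2 * (τ - τ ^ 2 / 2)) (M * ‖e‖ ^ 2 * (1 - τ)) τ := by
        have h := ((hasDerivAt_id τ).sub (((hasDerivAt_id τ).pow 2).div_const 2)).const_mul (M * ‖e‖ ^ 2)
        exact h.congr_deriv (by simp)
      exact this.hasDerivWithinAt)
    (fun τ hτ => by
      have hb : y + τ • e ∈ Metric.closedBall y δ := by
        rw [Metric.mem_closedBall, dist_eq_norm]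
        simp only [add_sub_cancel_left, norm_smul, Real.norm_eq_abs, abs_of_nonneg hτ.1]
        nlinarith [norm_nonneg e, hτ.2, hτ.1]
      have h1 := hLip _ hb _ hxb
      have h2 : ‖y + τ • e - x‖ = (1 - τ) * ‖e‖ := by
        have : y + τ • e - x = (-(1 - τ)) • e := by
          rw [hxe]; module
        rw [this, norm_smul, norm_neg, Real.norm_eq_abs, abs_of_nonneg (by linarith [hτ.2])]
      rw [h2] at h1
      have h3 := (H (y + τ • e) - H x).le_of_opNorm_le h1 e
      rw [sub_apply] at h3
      calc _ ≤ _ := h3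
        _ = _ := by ring)
    (x := 1) (by simp)
  simp only [φ, one_smul, ← hxe] at key
  calc _ ≤ _ := key
    _ = _ := by ring

/-- The reflection preserves norms. -/
theorem aux_refl {d k : ℕ} (v : Fin d → EuclideanSpace ℝ (Fin d))
    (hvon : ∀ p q : Fin d, (p : ℕ) < k → (q : ℕ) < k →
      ⟪v p, v q⟫ = if p = q then (1 : ℝ) else 0) (x : EuclideanSpace ℝ (Fin d)) :
    ‖(ContinuousLinearMap.id ℝ (EuclideanSpace ℝ (Fin d)) -
        (2 : ℝ) • ∑ p ∈ Finset.univ.filter (fun p : Fin d => (p : ℕ) < k), rk1 (v p)) x‖ = ‖x‖ := by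
  set S := Finset.univ.filter (fun p : Fin d => (p : ℕ) < k) with hS
  set y := ∑ p ∈ S, ⟪v p, x⟫ • v p with hy
  have hRx : (ContinuousLinearMap.id ℝ (EuclideanSpace ℝ (Fin d)) -
        (2 : ℝ) • ∑ p ∈ S, rk1 (v p)) x = x - (2 : ℝ) • y := by
    simp [rk1, hy]
  have h1 : ⟪x, y⟫ = ∑ p ∈ S, ⟪v p, x⟫ ^ 2 := by
    rw [hy, inner_sum]
    apply Finset.sum_congr rfl
    intro p _
    rw [inner_smul_right, real_inner_comm]
    ring
  have h2 : ⟪y, y⟫ = ∑ p ∈ S, ⟪v p, x⟫ ^ 2 := by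
    nth_rewrite 1 [hy]
    rw [sum_inner]
    apply Finset.sum_congr rfl
    intro p hp
    rw [inner_smul_left, hy, inner_sum]
    have : ∑ q ∈ S, ⟪v p, ⟪v q, x⟫ • v q⟫ = ∑ q ∈ S, if p = q then ⟪v q, x⟫ else 0 := by
      apply Finset.sum_congr rfl
      intro q hq
      rw [inner_smul_right, hvon p q (by simpa [hS] using hp) (by simpa [hS] using hq)]
      simp
    rw [this, Finset.sum_ite_eq, if_pos hp]
    simp [sq]
  rw [hRx]
  have h3 : ‖x - (2 : ℝ) • y‖ ^ 2 = ‖x‖ ^ 2 := by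
    rw [norm_sub_sq_real, inner_smul_right, norm_smul, mul_pow, ← real_inner_self_eq_norm_sq y, h1, h2]
    norm_num
    ring
  exact (sq_eq_sq₀ (norm_nonneg _) (norm_nonneg _)).mp h3

/-- Action of the reflection on the eigenvectors outside the middle block. -/
theorem aux_refl_eig {d s m k : ℕ} (hsk : s ≤ k) (hksm : k ≤ s + m)
    (u v : Fin d → EuclideanSpace ℝ (Fin d)) (hu : Orthonormal ℝ u)
    (hveq : ∀ p : Fin d, (p : ℕ) < s → v p = u p)
    (hvU : ∀ p : Fin d, s ≤ (p : ℕ) → (p : ℕ) < k →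
      v p ∈ Submodule.span ℝ (u '' {p : Fin d | s ≤ (p : ℕ) ∧ (p : ℕ) < s + m}))
    (p : Fin d) (hp : ¬ (s ≤ (p : ℕ) ∧ (p : ℕ) < s + m)) :
    (ContinuousLinearMap.id ℝ (EuclideanSpace ℝ (Fin d)) -
        (2 : ℝ) • ∑ p ∈ Finset.univ.filter (fun p : Fin d => (p : ℕ) < k), rk1 (v p)) (u p)
      = (if (p : ℕ) < s then (-1 : ℝ) else 1) • u p := by
  have horth : ∀ q : Fin d, (q : ℕ) < k → ⟪v q, u p⟫ = if q = p then (1 : ℝ) else 0 := by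
    intro q hq
    by_cases hqs : (q : ℕ) < s
    · rw [hveq q hqs]
      exact (orthonormal_iff_ite.mp hu) q p
    · push Not at hqs
      have hne : q ≠ p := by
        rintro rfl
        exact hp ⟨hqs, by omega⟩
      rw [if_neg hne]
      have : ∀ z ∈ Submodule.span ℝ (u '' {p : Fin d | s ≤ (p : ℕ) ∧ (p : ℕ) < s + m}),
          ⟪z, u p⟫ = 0 := by
        intro z hz
        induction hz using Submodule.span_induction with
        | mem z hz =>
          obtain ⟨j, hj, rfl⟩ := hz
          apply hu.inner_eq_zero
          rintro rfl
          exact hp hj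
        | zero => simp
        | add a b _ _ ha hb => rw [inner_add_left, ha, hb, add_zero]
        | smul c a _ ha => rw [inner_smul_left, ha, mul_zero]
      exact this _ (hvU q hqs hq)
  have hsum : ∑ q ∈ Finset.univ.filter (fun p : Fin d => (p : ℕ) < k), rk1 (v q) (u p)
      = ∑ q ∈ Finset.univ.filter (fun p : Fin d => (p : ℕ) < k), if q = p then v q else 0 := by
    apply Finset.sum_congr rfl
    intro q hq
    simp only [Finset.mem_filter, Finset.mem_univ, true_and] at hq
    simp [rk1, horth q hq]
  simp only [sub_apply, smul_apply,
    sum_apply, ContinuousLinearMap.id_apply]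
  rw [hsum, Finset.sum_ite_eq']
  by_cases hps : (p : ℕ) < s
  · rw [if_pos (by simp; omega), if_pos hps, hveq p hps]
    module
  · rw [if_neg (by simp; omega), if_neg hps]
    module

/-- Davis–Kahan type bound on the middle component. -/
theorem aux_dk {d : ℕ} (A B : EuclideanSpace ℝ (Fin d) →L[ℝ] EuclideanSpace ℝ (Fin d))
    (hBsymm : ∀ a b, ⟪B a, b⟫ = ⟪a, B b⟫)
    (b : Fin d → ℝ) (w : Fin d → EuclideanSpace ℝ (Fin d)) (hw : Orthonormal ℝ w)
    (hB : ∀ p, B (w p) = b p • w p) (μ : ℝ) (hμ : 0 < μ)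
    (hb : ∀ p, b p = 0 ∨ μ ≤ |b p|) (e : EuclideanSpace ℝ (Fin d))
    (he : e ∈ LinearMap.range (B : EuclideanSpace ℝ (Fin d) →ₗ[ℝ] EuclideanSpace ℝ (Fin d)))
    (η : ℝ) (hη : ‖A - B‖ ≤ η) (x : EuclideanSpace ℝ (Fin d)) (hx : ⟪x, e⟫ = ‖x‖ ^ 2)
    (hAx : ‖A x‖ ≤ η * ‖x‖) : ‖x‖ ≤ 2 * η * ‖e‖ / μ := by
  obtain ⟨y, hy⟩ := he
  have hy' : B y = e := hy
  set z := ∑ p, ((b p)⁻¹ * ⟪w p, e⟫) • w p with hz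
  have hzn : ‖z‖ ≤ μ⁻¹ * ‖e‖ := by
    have := aux_norm_le w hw Finset.univ (fun p => (b p)⁻¹) (fun p => ⟪w p, e⟫) μ⁻¹
      (by positivity) ?_
    · rwa [← aux_expand w hw e] at this
    · intro p _
      rcases hb p with h | h
      · simp [h, hμ.le]
      · rw [abs_inv]
        gcongr
  have hBz : B z = e := by
    rw [hz, map_sum]
    conv_rhs => rw [aux_expand w hw e]
    apply Finset.sum_congr rfl
    intro p _
    rw [map_smul, hB, smul_smul]
    congr 1
    by_cases h : b p = 0
    · have : ⟪w p, e⟫ = 0 := by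
        rw [← hy', ← hBsymm, hB, h]; simp
      rw [this]; simp
    · field_simp
  have h1 : ‖B x‖ ≤ 2 * η * ‖x‖ := by
    have h2 : B x = A x - (A - B) x := by simp
    rw [h2]
    calc _ ≤ ‖A x‖ + ‖(A - B) x‖ := norm_sub_le _ _
      _ ≤ η * ‖x‖ + η * ‖x‖ := add_le_add hAx ((A - B).le_of_opNorm_le hη x)
      _ = _ := by ring
  have hη0 : 0 ≤ η := (norm_nonneg _).trans hη
  have h3 : ‖x‖ ^ 2 ≤ (2 * η * ‖x‖) * (μ⁻¹ * ‖e‖) := by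
    rw [← hx, ← hBz, ← hBsymm, hBz]
    calc _ ≤ ‖B x‖ * ‖z‖ := real_inner_le_norm _ _
      _ ≤ _ := by gcongr
  rcases (norm_nonneg x).eq_or_lt with h | h
  · rw [← h]; positivity
  · have : ‖x‖ * ‖x‖ ≤ ‖x‖ * (2 * η * ‖e‖ / μ) := by
      calc _ = ‖x‖ ^ 2 := by ring
        _ ≤ _ := h3
        _ = _ := by ring
    exact le_of_mul_le_mul_left this h

/-- The main one-step estimate. -/
theorem aux_step {d : ℕ} (s m k : ℕ) (hsm : s + m ≤ d) (hsk : s ≤ k) (hksm : k ≤ s + m)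
    (A B : EuclideanSpace ℝ (Fin d) →L[ℝ] EuclideanSpace ℝ (Fin d))
    (hBsymm : ∀ a b, ⟪B a, b⟫ = ⟪a, B b⟫)
    (M L μ δ : ℝ) (hM : 0 < M) (hL : 0 < L) (hμ : 0 < μ)
    (hμL : μ ≤ L) (hMδ : M * δ ≤ μ / 4)
    (β : ℝ) (hβ0 : 0 < β) (hβ : β ≤ 2 / (L + μ))
    (e g : EuclideanSpace ℝ (Fin d)) (hclose : ‖e‖ < δ)
    (hAB : ‖A - B‖ ≤ M * ‖e‖) (hg : ‖g - A e‖ ≤ M * ‖e‖ ^ 2 / 2)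
    (lam : Fin d → ℝ) (u : Fin d → EuclideanSpace ℝ (Fin d))
    (hlam : Monotone lam) (hu : Orthonormal ℝ u)
    (heig : ∀ p : Fin d, A (u p) = lam p • u p)
    (hneg : ∀ p : Fin d, (p : ℕ) < s → lam p ∈ Set.Icc (-L) (-μ))
    (hpos : ∀ p : Fin d, s + m ≤ (p : ℕ) → lam p ∈ Set.Icc μ L)
    (lamh : Fin d → ℝ) (uh : Fin d → EuclideanSpace ℝ (Fin d))
    (huh : Orthonormal ℝ uh)
    (heigh : ∀ p : Fin d, B (uh p) = lamh p • uh p)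
    (hnegh : ∀ p : Fin d, (p : ℕ) < s → lamh p ∈ Set.Icc (-L) (-μ))
    (hzeroh : ∀ p : Fin d, s ≤ (p : ℕ) → (p : ℕ) < s + m → lamh p = 0)
    (hposh : ∀ p : Fin d, s + m ≤ (p : ℕ) → lamh p ∈ Set.Icc μ L)
    (hrange : e ∈ LinearMap.range (B : EuclideanSpace ℝ (Fin d) →ₗ[ℝ] EuclideanSpace ℝ (Fin d)))
    (v : Fin d → EuclideanSpace ℝ (Fin d))
    (hvon : ∀ p q : Fin d, (p : ℕ) < k → (q : ℕ) < k →
      ⟪v p, v q⟫ = if p = q then (1 : ℝ) else 0)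
    (hveq : ∀ p : Fin d, (p : ℕ) < s → v p = u p)
    (hvU : ∀ p : Fin d, s ≤ (p : ℕ) → (p : ℕ) < k →
      v p ∈ Submodule.span ℝ (u '' {p : Fin d | s ≤ (p : ℕ) ∧ (p : ℕ) < s + m})) :
    ‖e - β • ((ContinuousLinearMap.id ℝ (EuclideanSpace ℝ (Fin d)) -
        (2 : ℝ) • ∑ p ∈ Finset.univ.filter (fun p : Fin d => (p : ℕ) < k), rk1 (v p)) g)‖
      ≤ (1 - μ * β) * ‖e‖ + (5 / 2 * β * M + 2 * M / μ) * ‖e‖ ^ 2 := by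
  have hRn := aux_refl (k := k) v hvon
  have hRe := aux_refl_eig hsk hksm u v hu hveq hvU
  set R := (ContinuousLinearMap.id ℝ (EuclideanSpace ℝ (Fin d)) -
        (2 : ℝ) • ∑ p ∈ Finset.univ.filter (fun p : Fin d => (p : ℕ) < k), rk1 (v p)) with hR
  set r := ‖e‖ with hr
  have hr0 : 0 ≤ r := norm_nonneg e
  have hβL : β * (L + μ) ≤ 2 := by rwa [le_div_iff₀ (by linarith)] at hβ
  have hq : μ * β ≤ 1 := by nlinarith
  have hmid := aux_middle hsm A B lam lamh u uh hu huh heig heigh hlam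
    (fun p hp => by
      by_cases h : (p : ℕ) < s
      · have := (hnegh p h).2; linarith
      · exact (hzeroh p (by omega) hp).le)
    (fun p hp => by
      by_cases h : (p : ℕ) < s + m
      · exact (hzeroh p hp h).ge
      · have := (hposh p (by omega)).1; linarith) (M * r) hAB
  let S := Finset.univ.filter (fun p : Fin d => s ≤ (p : ℕ) ∧ (p : ℕ) < s + m)
  let S' := Finset.univ.filter (fun p : Fin d => ¬ (s ≤ (p : ℕ) ∧ (p : ℕ) < s + m))
  set x := ∑ p ∈ S, ⟪u p, e⟫ • u p with hx
  set w := ∑ p ∈ S', ⟪u p, e⟫ • u p with hw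
  have hxw : e = x + w := by
    rw [hx, hw, Finset.sum_filter_add_sum_filter_not]
    exact aux_expand u hu e
  have hAx : ‖A x‖ ≤ M * r * ‖x‖ := by
    have h1 : A x = ∑ p ∈ S, (lam p * ⟪u p, e⟫) • u p := by
      rw [hx, map_sum]
      refine Finset.sum_congr rfl fun p _ => ?_
      rw [map_smul, heig, smul_smul, mul_comm]
    rw [h1]
    apply aux_norm_le u hu S lam (fun p => ⟪u p, e⟫) _ (by positivity)
    intro p hp
    simp only [S, Finset.mem_filter, Finset.mem_univ, true_and] at hp
    exact hmid p hp.1 hp.2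
  have hxe : ⟪x, e⟫ = ‖x‖ ^ 2 := by
    rw [hx, aux_norm_sq u hu S (fun p => ⟪u p, e⟫), sum_inner]
    refine Finset.sum_congr rfl fun p _ => ?_
    rw [inner_smul_left]
    simp [sq]
  have hxn : ‖x‖ ≤ 2 * (M * r) * r / μ := by
    apply aux_dk A B hBsymm lamh uh huh heigh μ hμ ?_ e hrange (M * r) hAB x hxe hAx
    intro p
    by_cases h : (p : ℕ) < s
    · right
      rw [le_abs]; right
      have := (hnegh p h).2; linarith
    · by_cases h' : (p : ℕ) < s + m
      · left; exact hzeroh p (by omega) h'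
      · right
        rw [le_abs]; left
        exact (hposh p (by omega)).1
  have hwn : ‖w‖ ≤ r := by
    apply le_of_sq_le_sq _ hr0
    rw [hw, hr, aux_norm_sq u hu S' (fun p => ⟪u p, e⟫), aux_nsq u hu e]
    exact Finset.sum_le_sum_of_subset_of_nonneg (Finset.filter_subset _ _)
      (fun _ _ _ => sq_nonneg _)
  have hcon : ‖w - β • R (A w)‖ ≤ (1 - μ * β) * ‖w‖ := by
    have h1 : w - β • R (A w) = ∑ p ∈ S', ((1 - β * (lam p *
        (if (p : ℕ) < s then (-1 : ℝ) else 1))) * ⟪u p, e⟫) • u p := by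
      rw [hw, map_sum, map_sum, Finset.smul_sum, ← Finset.sum_sub_distrib]
      refine Finset.sum_congr rfl fun p hp => ?_
      simp only [S', Finset.mem_filter, Finset.mem_univ, true_and] at hp
      rw [map_smul, heig, map_smul, map_smul, hRe p hp]
      module
    rw [h1]
    apply aux_norm_le u hu S' (fun p => 1 - β * (lam p *
        (if (p : ℕ) < s then (-1 : ℝ) else 1))) (fun p => ⟪u p, e⟫) _ (by linarith)
    intro p hp
    simp only [S', Finset.mem_filter, Finset.mem_univ, true_and] at hp
    rw [abs_le]
    by_cases h : (p : ℕ) < s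
    · have := hneg p h
      simp only [h, if_true]
      constructor <;> nlinarith [this.1, this.2]
    · have := hpos p (by omega)
      simp only [h, if_false]
      constructor <;> nlinarith [this.1, this.2]
  have hdec : e - β • R g = (w - β • R (A w)) + x - β • R (A x) - β • R (g - A e) := by
    have hAe : A e = A x + A w := by rw [← map_add, ← hxw]
    have h1 : g = A w + A x + (g - A e) := by
      rw [hAe]; abel
    have h2 : R g = R (A w) + R (A x) + R (g - A e) := by
      rw [← map_add, ← map_add, ← h1]
    have h3 : e - β • R g = (x + w) - β • R g := by rw [← hxw]
    rw [h3, h2]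
    module
  have hMr : M * r ≤ μ / 4 := by nlinarith
  rw [hdec]
  have hb1 : ‖β • R (A x)‖ ≤ β * (μ / 4 * ‖x‖) := by
    rw [norm_smul, hRn, Real.norm_eq_abs, abs_of_pos hβ0]
    gcongr
    exact hAx.trans (by gcongr)
  have hb2 : ‖β • R (g - A e)‖ ≤ β * (M * r ^ 2 / 2) := by
    rw [norm_smul, hRn, Real.norm_eq_abs, abs_of_pos hβ0]
    gcongr
  have hx2 : μ * ‖x‖ ≤ 2 * M * r ^ 2 := by
    rw [le_div_iff₀ hμ] at hxn
    nlinarith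
  have hxn' : ‖x‖ ≤ 2 * M / μ * r ^ 2 := by
    calc _ ≤ _ := hxn
      _ = _ := by ring
  calc _ ≤ ‖w - β • R (A w)‖ + ‖x‖ + ‖β • R (A x)‖ + ‖β • R (g - A e)‖ := by
        refine (norm_sub_le _ _).trans ?_
        gcongr
        refine (norm_sub_le _ _).trans ?_
        gcongr
        exact norm_add_le _ _
    _ ≤ (1 - μ * β) * r + 2 * M / μ * r ^ 2 + β * (μ / 4 * ‖x‖) + β * (M * r ^ 2 / 2) := by
        gcongr
        exact hcon.trans (mul_le_mul_of_nonneg_left hwn (by linarith))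
    _ ≤ _ := by
        have : β * (μ * ‖x‖) ≤ β * (2 * M * r ^ 2) := by gcongr
        have : 0 ≤ β * M * r ^ 2 := by positivity
        nlinarith

/-- The scalar recursion. -/
theorem aux_rec (r : ℕ → ℝ) (hr : ∀ t, 0 ≤ r t) (q ρ : ℝ) (hq : 0 < q) (hρ : 0 < ρ) (h0 : r 0 < ρ)
    (hstep : ∀ t, r (t + 1) ≤ (1 - q) * r t + q / ρ * r t ^ 2) :
    (∀ t, r (t + 1) ≤ r t) ∧
    (∀ t, r t ≤ ((1 + q)⁻¹) ^ t * (ρ * r 0 / (ρ - r 0))) ∧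
    Filter.Tendsto r Filter.atTop (nhds 0) := by
  have hs : ∀ t, r (t + 1) ≤ r t * (1 - q * (1 - r t / ρ)) := fun t => by
    calc _ ≤ _ := hstep t
      _ = _ := by ring
  have hmono1 : ∀ t, r t < ρ → r (t + 1) ≤ r t := fun t ht => by
    have h1 : 0 ≤ 1 - r t / ρ := by
      rw [sub_nonneg, div_le_one hρ]; exact ht.le
    have := mul_nonneg (hr t) (mul_nonneg hq.le h1)
    have := hs t
    nlinarith
  have hlt : ∀ t, r t < ρ := by
    intro t
    induction t with
    | zero => exact h0
    | succ t ih => exact (hmono1 t ih).trans_lt ih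
  -- the quantity r/(ρ - r) contracts
  have hcon : ∀ t, r (t + 1) / (ρ - r (t + 1)) ≤ (1 + q)⁻¹ * (r t / (ρ - r t)) := by
    intro t
    have h1 := hlt t
    have h2 := hlt (t + 1)
    rw [← div_eq_inv_mul, div_div, div_le_div_iff₀ (by linarith) (by nlinarith)]
    have h3 : ρ * r (t + 1) ≤ r t * (ρ - q * (ρ - r t)) := by
      have := mul_le_mul_of_nonneg_left (hs t) hρ.le
      calc _ ≤ _ := this
        _ = _ := by field_simp
    -- multiply by ρ + q (ρ - r)
    have h4 : 0 < ρ + q * (ρ - r t) := by nlinarith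
    have h5 : ρ * r (t + 1) * (ρ + q * (ρ - r t)) ≤ r t * ρ ^ 2 := by
      have := mul_le_mul_of_nonneg_right h3 h4.le
      have h6 : 0 ≤ r t * (q * (ρ - r t)) ^ 2 := mul_nonneg (hr t) (sq_nonneg _)
      nlinarith
    have h7 : r (t + 1) * (ρ + q * (ρ - r t)) ≤ r t * ρ := by
      apply le_of_mul_le_mul_left _ hρ
      nlinarith
    nlinarith
  have hpow : ∀ t, r t / (ρ - r t) ≤ ((1 + q)⁻¹) ^ t * (r 0 / (ρ - r 0)) := by
    intro t
    induction t with
    | zero => simp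
    | succ t ih =>
      calc _ ≤ _ := hcon t
        _ ≤ (1 + q)⁻¹ * (((1 + q)⁻¹) ^ t * (r 0 / (ρ - r 0))) := by gcongr
        _ = _ := by ring
  have hbd : ∀ t, r t ≤ ((1 + q)⁻¹) ^ t * (ρ * r 0 / (ρ - r 0)) := by
    intro t
    have h1 : 0 < ρ - r t := by linarith [hlt t]
    have h2 : r t ≤ ρ * (r t / (ρ - r t)) := by
      rw [← mul_div_assoc, le_div_iff₀ h1]
      nlinarith [hr t]
    calc _ ≤ _ := h2
      _ ≤ ρ * (((1 + q)⁻¹) ^ t * (r 0 / (ρ - r 0))) := by gcongr; exact hpow t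
      _ = _ := by ring
  refine ⟨fun t => hmono1 t (hlt t), hbd, ?_⟩
  have hlim : Filter.Tendsto (fun t : ℕ => ((1 + q)⁻¹) ^ t * (ρ * r 0 / (ρ - r 0)))
      Filter.atTop (nhds 0) := by
    have := (tendsto_pow_atTop_nhds_zero_of_lt_one (r := (1 + q)⁻¹) (by positivity)
      (inv_lt_one_of_one_lt₀ (by linarith))).mul_const (ρ * r 0 / (ρ - r 0))
    simpa using this
  exact squeeze_zero hr hbd hlim

theorem stmt14 {d : ℕ} (s m k : ℕ) (hsm : s + m ≤ d) (hsk : s ≤ k) (hksm : k ≤ s + m)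
    (f : EuclideanSpace ℝ (Fin d) → ℝ) (hf : ContDiff ℝ 2 f)
    (H : EuclideanSpace ℝ (Fin d) → EuclideanSpace ℝ (Fin d) →L[ℝ] EuclideanSpace ℝ (Fin d))
    (hH : ∀ x : EuclideanSpace ℝ (Fin d), HasFDerivAt (gradient f) (H x) x)
    (hHsymm : ∀ x : EuclideanSpace ℝ (Fin d), ∀ a b : EuclideanSpace ℝ (Fin d), ⟪(H x) a, b⟫ = ⟪a, (H x) b⟫)
    (M L μ δ : ℝ) (hM : 0 < M) (hL : 0 < L) (hμ : 0 < μ) (hδ : 0 < δ)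
    (hμL : μ ≤ L) (hMδ : M * δ ≤ μ / 4)
    (β : ℝ) (hβ0 : 0 < β) (hβ : β ≤ 2 / (L + μ))
    (θ θh : ℕ → EuclideanSpace ℝ (Fin d))
    (hcrit : ∀ t : ℕ, gradient f (θh t) = 0)
    (hclose : ∀ t : ℕ, ‖θ t - θh t‖ < δ)
    (hLip : ∀ t : ℕ, ∀ a ∈ Metric.closedBall (θh t) δ, ∀ b ∈ Metric.closedBall (θh t) δ,
      ‖H a - H b‖ ≤ M * ‖a - b‖)
    (lam : ℕ → Fin d → ℝ) (u : ℕ → Fin d → EuclideanSpace ℝ (Fin d))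
    (hlam : ∀ t : ℕ, Monotone (lam t)) (hu : ∀ t : ℕ, Orthonormal ℝ (u t))
    (heig : ∀ t : ℕ, ∀ p : Fin d, (H (θ t)) (u t p) = lam t p • u t p)
    (hneg : ∀ t : ℕ, ∀ p : Fin d, (p : ℕ) < s → lam t p ∈ Set.Icc (-L) (-μ))
    (hpos : ∀ t : ℕ, ∀ p : Fin d, s + m ≤ (p : ℕ) → lam t p ∈ Set.Icc μ L)
    (lamh : ℕ → Fin d → ℝ) (uh : ℕ → Fin d → EuclideanSpace ℝ (Fin d))
    (hlamh : ∀ t : ℕ, Monotone (lamh t)) (huh : ∀ t : ℕ, Orthonormal ℝ (uh t))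
    (heigh : ∀ t : ℕ, ∀ p : Fin d, (H (θh t)) (uh t p) = lamh t p • uh t p)
    (hnegh : ∀ t : ℕ, ∀ p : Fin d, (p : ℕ) < s → lamh t p ∈ Set.Icc (-L) (-μ))
    (hzeroh : ∀ t : ℕ, ∀ p : Fin d, s ≤ (p : ℕ) → (p : ℕ) < s + m → lamh t p = 0)
    (hposh : ∀ t : ℕ, ∀ p : Fin d, s + m ≤ (p : ℕ) → lamh t p ∈ Set.Icc μ L)
    (hrange : ∀ t : ℕ, θ t - θh t ∈ LinearMap.range ((H (θh t)) : EuclideanSpace ℝ (Fin d) →ₗ[ℝ] EuclideanSpace ℝ (Fin d)))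
    (v : ℕ → Fin d → EuclideanSpace ℝ (Fin d))
    (hvon : ∀ t : ℕ, ∀ p q : Fin d, (p : ℕ) < k → (q : ℕ) < k →
      ⟪v t p, v t q⟫ = if p = q then (1 : ℝ) else 0)
    (hveq : ∀ t : ℕ, ∀ p : Fin d, (p : ℕ) < s → v t p = u t p)
    (hvU : ∀ t : ℕ, ∀ p : Fin d, s ≤ (p : ℕ) → (p : ℕ) < k →
      v t p ∈ Submodule.span ℝ (u t '' {p : Fin d | s ≤ (p : ℕ) ∧ (p : ℕ) < s + m}))
    (hiter : ∀ t : ℕ, θ (t + 1) = θ t - β •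
      ((ContinuousLinearMap.id ℝ (EuclideanSpace ℝ (Fin d)) -
        (2 : ℝ) • ∑ p ∈ Finset.univ.filter (fun p : Fin d => (p : ℕ) < k), rk1 (v t p))
        (gradient f (θ t))))
    (hnear : ∀ t : ℕ, ‖θ (t + 1) - θh (t + 1)‖ ≤ ‖θ (t + 1) - θh t‖)
    (h0 : ‖θ 0 - θh 0‖ < 2 * μ ^ 2 * β / ((5 * μ * β + 4) * M)) :
    (∀ t : ℕ, ‖θ (t + 1) - θh (t + 1)‖ ≤ ‖θ t - θh t‖) ∧
    (∀ t : ℕ, ‖θ t - θh t‖ ≤ ((1 + μ * β)⁻¹) ^ t *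
      ((2 * μ ^ 2 * β / ((5 * μ * β + 4) * M)) * ‖θ 0 - θh 0‖ /
        (2 * μ ^ 2 * β / ((5 * μ * β + 4) * M) - ‖θ 0 - θh 0‖))) ∧
    Filter.Tendsto (fun t : ℕ => ‖θ t - θh t‖) Filter.atTop (nhds 0) := by
  have hβL : β * (L + μ) ≤ 2 := by rwa [le_div_iff₀ (by linarith)] at hβ
  refine aux_rec (fun t => ‖θ t - θh t‖) (fun t => norm_nonneg _) (μ * β)
    (2 * μ ^ 2 * β / ((5 * μ * β + 4) * M)) (by positivity) (by positivity) h0 ?_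
  intro t
  have hcb : θh t ∈ Metric.closedBall (θh t) δ := Metric.mem_closedBall_self hδ.le
  have hxb : θ t ∈ Metric.closedBall (θh t) δ := by
    rw [Metric.mem_closedBall, dist_eq_norm]; exact (hclose t).le
  have hstep := aux_step s m k hsm hsk hksm (H (θ t)) (H (θh t)) (hHsymm _) M L μ δ hM hL hμ hμL
    hMδ β hβ0 hβ (θ t - θh t) (gradient f (θ t)) (hclose t) (hLip t _ hxb _ hcb)
    (aux_taylor (gradient f) H hH (θ t) (θh t) (hcrit t) M δ hM (hclose t) (hLip t))
    (lam t) (u t) (hlam t) (hu t) (heig t) (hneg t) (hpos t) (lamh t) (uh t) (huh t) (heigh t)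
    (hnegh t) (hzeroh t) (hposh t) (hrange t) (v t) (hvon t) (hveq t) (hvU t)
  have h1 := hnear t
  have h2 : θ (t + 1) - θh t = θ t - θh t - β •
      ((ContinuousLinearMap.id ℝ (EuclideanSpace ℝ (Fin d)) -
        (2 : ℝ) • ∑ p ∈ Finset.univ.filter (fun p : Fin d => (p : ℕ) < k), rk1 (v t p))
        (gradient f (θ t))) := by
    rw [hiter t]; abel
  rw [h2] at h1
  have h3 : μ * β / (2 * μ ^ 2 * β / ((5 * μ * β + 4) * M)) = 5 / 2 * β * M + 2 * M / μ := by
    field_simp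
    ring
  simp only [h3]
  exact h1.trans hstep
end
end
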